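/- Let L be a K-Lie subalgebra of Der_K(R) and let I be a Lie ideal of L. Then the K-subspace span_R(I) ∩ L of L is also a Lie ideal of L. -/

import Mathlib

/-!
Setting: `K` is a field, `R` is a field extension of `K` (in the paper, `R` is the
quotient field of an integral `K`-domain `A`).  `Derivation K R R` is the Lie algebra
`Der_K(R)` of all `K`-derivations of `R`; it is an `R`-vector space and a Lie algebra
over `K`.
-/

variable {K R : Type*} [Field K] [Field R] [Algebra K R]

/-- The field of constants `F(L) = {r ∈ R : D r = 0 for all D ∈ L}` of a
`K`-Lie subalgebra `L` of `Der_K(R)`. -/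
def constField (L : LieSubalgebra K (Derivation K R R)) : Subfield R where
  carrier := {r : R | ∀ D ∈ L, D r = 0}
  zero_mem' := fun D _ => map_zero D
  one_mem' := fun D _ => D.map_one_eq_zero
  add_mem' := fun {a b} ha hb D hD => by rw [map_add, ha D hD, hb D hD, add_zero]
  mul_mem' := fun {a b} ha hb D hD => by
    rw [D.leibniz, ha D hD, hb D hD, smul_zero, smul_zero, add_zero]
  neg_mem' := fun {a} ha D hD => by rw [map_neg, ha D hD, neg_zero]
  inv_mem' := fun a ha D hD => by rw [D.leibniz_inv, ha D hD, smul_zero]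

/-- The Leibniz rule for the bracket of a derivation with a multiple of a derivation. -/
theorem Derivation.lie_smul_eq_add (D E : Derivation K R R) (r : R) :
    ⁅D, r • E⁆ = D r • E + r • ⁅D, E⁆ := by
  ext a
  simp only [Derivation.commutator_apply, Derivation.add_apply, Derivation.smul_apply,
    smul_eq_mul, Derivation.leibniz]
  ring

/-- If bracketing with `D` maps `S` into its `R`-span, it preserves this span. -/
theorem Derivation.lie_mem_span {S : Set (Derivation K R R)} {D E : Derivation K R R}
    (hD : ∀ s ∈ S, ⁅D, s⁆ ∈ Submodule.span R S) (hE : E ∈ Submodule.span R S) :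
    ⁅D, E⁆ ∈ Submodule.span R S := by
  induction hE using Submodule.span_induction with
  | mem s hs => exact hD s hs
  | zero => simp
  | add x y _ _ hx hy => rw [lie_add]; exact add_mem hx hy
  | smul r x hxS hx =>
    rw [Derivation.lie_smul_eq_add]
    exact add_mem (Submodule.smul_mem _ _ hxS) (Submodule.smul_mem _ _ hx)

/-- Let `L` be a `K`-Lie subalgebra of `Der_K(R)` and `I` a Lie
ideal of `L`.  Then `span_R(I) ∩ L` is again a Lie ideal of `L`. -/
theorem span_inter_is_lieIdeal
    (L : LieSubalgebra K (Derivation K R R)) (I : LieIdeal K L) :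
    ∃ J : LieIdeal K L, ∀ x : L,
      x ∈ J ↔ (x : Derivation K R R) ∈
        Submodule.span R (Subtype.val '' (I : Set L)) := by
  refine ⟨{ ((Submodule.span R (Subtype.val '' (I : Set L))).restrictScalars K).comap
              L.toSubmodule.subtype with
            lie_mem := fun {x m} hm => Derivation.lie_mem_span ?_ hm }, fun _ => Iff.rfl⟩
  rintro _ ⟨s, hs, rfl⟩
  exact Submodule.subset_span ⟨⁅x, s⁆, lie_mem_right K L I x s hs, rfl⟩
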